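/- arXiv:0712.3384 — 5 statements merged into one kernel-verified Lean document; each statement's English description precedes it below -/
import Mathlib

section
/- Let V be a finite-dimensional vector space over a field k of characteristic different from 2, and let σ₁, σ₂ : V → V be linear involutions (σᵢ ∘ σᵢ = id). If the composite τ := σ₂ ∘ σ₁ is a semisimple endomorphism of V, then V is the internal direct sum V = (V^{σ₁} + V^{σ₂}) ⊕ (V^{−σ₁} ∩ V^{−σ₂}); that is, the subspaces V^{σ₁} + V^{σ₂} and V^{−σ₁} ∩ V^{−σ₂} intersect trivially and span V. -/
/-- The kernel and the range of a semisimple endomorphism are complementary. -/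
theorem Module.End.IsSemisimple.isCompl_ker_range {R M : Type*} [CommRing R] [AddCommGroup M]
    [Module R M] {f : Module.End R M} (hf : f.IsSemisimple) :
    IsCompl (LinearMap.ker f) (LinearMap.range f) := by
  rw [Module.End.isSemisimple_iff] at hf
  constructor
  · obtain ⟨q, hq, hc⟩ := hf (LinearMap.ker f) fun x hx => by
      rw [LinearMap.mem_ker] at hx
      simp [hx]
    rw [Submodule.disjoint_def]
    rintro _ hv ⟨u, rfl⟩
    obtain ⟨a, ha, b, hb, rfl⟩ := Submodule.mem_sup.1 (hc.sup_eq_top ▸ Submodule.mem_top (x := u))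
    rw [map_add, LinearMap.mem_ker.1 ha, zero_add] at hv ⊢
    exact Submodule.disjoint_def.1 hc.disjoint _ hv (hq hb)
  · obtain ⟨q, hq, hc⟩ := hf (LinearMap.range f) fun x _ => LinearMap.mem_range_self f x
    have hle : q ≤ LinearMap.ker f := fun x hx =>
      Submodule.disjoint_def.1 hc.disjoint _ (LinearMap.mem_range_self f x) (hq hx)
    exact (hc.codisjoint.mono_right hle).symm

/-- Let `V` be a finite-dimensional vector space over a field `k` of
characteristic different from 2 and let `σ₁, σ₂` be linear involutions of `V`.
If `τ := σ₂ ∘ σ₁` is a semisimple endomorphism, then `V` is the internal direct sum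
`V = (V^{σ₁} + V^{σ₂}) ⊕ (V^{−σ₁} ∩ V^{−σ₂})`. -/
theorem matsuki_decomposition
    {k V : Type*} [Field k] [AddCommGroup V] [Module k V] [FiniteDimensional k V]
    (hchar : (2 : k) ≠ 0)
    (σ₁ σ₂ : Module.End k V) (h₁ : σ₁ * σ₁ = 1) (h₂ : σ₂ * σ₂ = 1)
    (hτ : (σ₂ * σ₁).IsSemisimple) :
    IsCompl (LinearMap.ker (σ₁ - 1) ⊔ LinearMap.ker (σ₂ - 1))
      (LinearMap.ker (σ₁ + 1) ⊓ LinearMap.ker (σ₂ + 1)) := by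
  have hss : (σ₂ * σ₁ - 1).IsSemisimple := by
    have := (Module.End.isSemisimple_sub_algebraMap_iff (f := σ₂ * σ₁) (μ := (1 : k))).2 hτ
    rwa [map_one] at this
  have hc := hss.isCompl_ker_range
  have e₁ (x : V) : σ₁ (σ₁ x) = x := LinearMap.congr_fun h₁ x
  have e₂ (x : V) : σ₂ (σ₂ x) = x := LinearMap.congr_fun h₂ x
  constructor
  · rw [Submodule.disjoint_def]
    rintro v hv ⟨hv₁, hv₂⟩
    obtain ⟨a, ha, b, hb, rfl⟩ := Submodule.mem_sup.1 hv
    simp only [SetLike.mem_coe, LinearMap.mem_ker, LinearMap.add_apply, LinearMap.sub_apply,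
      Module.End.one_apply] at ha hb hv₁ hv₂
    have hfix : a + b ∈ LinearMap.ker (σ₂ * σ₁ - 1) := by
      simp only [LinearMap.mem_ker, LinearMap.sub_apply, Module.End.mul_apply,
        Module.End.one_apply]
      rw [eq_neg_of_add_eq_zero_left hv₁, map_neg, eq_neg_of_add_eq_zero_left hv₂]
      abel
    have himg : (σ₂ * σ₁ - 1) a = -((2 : k) • (a + b)) := by
      simp only [LinearMap.sub_apply, Module.End.mul_apply, Module.End.one_apply]
      rw [sub_eq_zero.1 ha]
      rw [map_add, sub_eq_zero.1 hb] at hv₂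
      linear_combination (norm := module) hv₂
    have hzero := Submodule.disjoint_def.1 hc.disjoint _
      (Submodule.neg_mem _ (Submodule.smul_mem _ (2 : k) hfix)) ⟨a, himg⟩
    exact (smul_eq_zero.1 (neg_eq_zero.1 hzero)).resolve_left hchar
  · have m₁ (x : V) : x + σ₁ x ∈ LinearMap.ker (σ₁ - 1) := by simp [e₁, add_comm]
    have m₂ (x : V) : x + σ₂ x ∈ LinearMap.ker (σ₂ - 1) := by simp [e₂, add_comm]
    rw [codisjoint_iff_le_sup, ← hc.sup_eq_top]
    refine sup_le (fun v hv => ?_) (le_sup_of_le_left ?_)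
    · have hv' : σ₂ (σ₁ v) = v := sub_eq_zero.1 hv
      have hv₂ : σ₂ v = σ₁ v := by rw [← e₂ (σ₁ v), hv']
      have hdecomp : v = (2⁻¹ : k) • (v + σ₁ v) + (2⁻¹ : k) • (v - σ₁ v) := by
        rw [← smul_add, add_add_sub_cancel, ← two_smul k v, inv_smul_smul₀ hchar]
      rw [hdecomp]
      refine Submodule.add_mem_sup
        (Submodule.smul_mem _ _ (Submodule.mem_sup_left (m₁ v)))
        (Submodule.smul_mem _ _ ⟨?_, ?_⟩)
      · simp [e₁]
      · simp [hv', hv₂]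
    · rintro _ ⟨v, rfl⟩
      have hsplit : (σ₂ * σ₁ - 1) v = -(v + σ₁ v) + (σ₁ v + σ₂ (σ₁ v)) := by
        simp only [LinearMap.sub_apply, Module.End.mul_apply, Module.End.one_apply]
        abel
      rw [hsplit]
      exact Submodule.add_mem_sup (Submodule.neg_mem _ (m₁ v)) (m₂ _)
end

section
/- Let g be a finite-dimensional complex Lie algebra, let σ be an involutive Lie algebra automorphism of g with eigenspace decomposition g = h ⊕ q where h := g^σ and q := g^{−σ}, and let η₀ ∈ q be an element such that ad(η₀) : g → g is a semisimple endomorphism. Then q is the internal direct sum q = ⁅h, η₀⁆ ⊕ (q ∩ ker(ad η₀)), where ⁅h, η₀⁆ denotes the subspace {⁅x, η₀⁆ : x ∈ h}. -/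
/-- The kernel and the range of a semisimple endomorphism are disjoint. -/
theorem Module.End.IsSemisimple.disjoint_ker_range {R M : Type*} [CommRing R] [AddCommGroup M]
    [Module R M] {f : Module.End R M} (hf : f.IsSemisimple) :
    Disjoint (LinearMap.ker f) (LinearMap.range f) := by
  obtain ⟨C, hC, hcompl⟩ := Module.End.isSemisimple_iff.mp hf (LinearMap.ker f) fun x hx => by
    simp_all
  rw [Submodule.disjoint_def]
  rintro _ hy ⟨x, rfl⟩
  obtain ⟨k, hk, c, hc, rfl⟩ :=
    Submodule.mem_sup.mp (hcompl.sup_eq_top ▸ Submodule.mem_top (x := x))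
  refine Submodule.disjoint_def.mp hcompl.disjoint _ hy ?_
  rw [map_add, LinearMap.mem_ker.mp hk, zero_add]
  exact hC hc

/-- The kernel and the range of a semisimple endomorphism of a finite-dimensional vector space
span it. -/
theorem Module.End.IsSemisimple.ker_sup_range {K V : Type*} [Field K] [AddCommGroup V]
    [Module K V] [FiniteDimensional K V] {f : Module.End K V} (hf : f.IsSemisimple) :
    LinearMap.ker f ⊔ LinearMap.range f = ⊤ :=
  Submodule.eq_top_of_disjoint _ _
    (by rw [add_comm, LinearMap.finrank_range_add_finrank_ker]) hf.disjoint_ker_range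

/-- Let `g` be a finite-dimensional complex Lie algebra, `σ` an involutive
automorphism with eigenspaces `h = g^σ`, `q = g^{−σ}`, and let `η₀ ∈ q` be such that
`ad η₀` is a semisimple endomorphism.  Then `q = ⁅h, η₀⁆ ⊕ (q ∩ ker (ad η₀))`,
an internal direct sum. -/
theorem slice_decomposition_symmetric_pair
    {g : Type*} [LieRing g] [LieAlgebra ℂ g] [FiniteDimensional ℂ g]
    (σ : g ≃ₗ⁅ℂ⁆ g) (hσ : ∀ x, σ (σ x) = x)
    (η₀ : g) (hη₀ : σ η₀ = -η₀)
    (hss : (LieAlgebra.ad ℂ g η₀).IsSemisimple) :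
    Disjoint (Submodule.map (-(LieAlgebra.ad ℂ g η₀))
          (LinearMap.ker ((σ : g →ₗ[ℂ] g) - 1)))
        (LinearMap.ker ((σ : g →ₗ[ℂ] g) + 1) ⊓ LinearMap.ker (LieAlgebra.ad ℂ g η₀)) ∧
    Submodule.map (-(LieAlgebra.ad ℂ g η₀)) (LinearMap.ker ((σ : g →ₗ[ℂ] g) - 1)) ⊔
        (LinearMap.ker ((σ : g →ₗ[ℂ] g) + 1) ⊓ LinearMap.ker (LieAlgebra.ad ℂ g η₀)) =
      LinearMap.ker ((σ : g →ₗ[ℂ] g) + 1) := by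
  have hanti (x : g) : σ ⁅η₀, x⁆ = -⁅η₀, σ x⁆ := by
    rw [LieEquiv.map_lie, hη₀, neg_lie]
  refine ⟨?_, le_antisymm (sup_le ?_ inf_le_left) ?_⟩
  · refine hss.disjoint_ker_range.symm.mono ?_ inf_le_right
    rintro _ ⟨x, -, rfl⟩
    exact ⟨-x, by simp⟩
  · rintro _ ⟨x, hx, rfl⟩
    have hx' : σ x = x := by simpa [sub_eq_zero] using hx
    have hskew : ⁅η₀, x⁆ + ⁅x, η₀⁆ = 0 := by rw [← lie_skew x η₀, add_neg_cancel]
    simp [LieEquiv.map_lie, hη₀, hx', hskew]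
  · intro x hx
    have hx' : σ x = -x := by simpa [add_eq_zero_iff_eq_neg] using hx
    obtain ⟨k, hk, _, ⟨y, rfl⟩, hky⟩ :=
      Submodule.mem_sup.mp (hss.ker_sup_range ▸ Submodule.mem_top (x := x))
    have hk' : ⁅η₀, k⁆ = 0 := by simpa using hk
    have hσk : ⁅η₀, σ k⁆ = 0 := by rw [← neg_eq_zero, ← hanti, hk', map_zero]
    have hσx : σ k - ⁅η₀, σ y⁆ = -x := by
      rw [← hx', ← hky, LieAlgebra.ad_apply, map_add, hanti, sub_eq_add_neg]
    rw [LieAlgebra.ad_apply] at hky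
    refine Submodule.mem_sup.mpr ⟨_, ⟨-((1 / 2 : ℂ) • (y + σ y)), ?_, rfl⟩,
      (1 / 2 : ℂ) • (k - σ k), ⟨?_, ?_⟩, ?_⟩
    · simp [hσ, add_comm]
    · simp [hσ]
    · simp [hk', hσk]
    · have hsum : ⁅η₀, y⁆ + ⁅η₀, σ y⁆ + (k - σ k) = (2 : ℂ) • x := by
        rw [two_smul, show ⁅η₀, y⁆ + ⁅η₀, σ y⁆ + (k - σ k) =
          k + ⁅η₀, y⁆ - (σ k - ⁅η₀, σ y⁆) by abel, hky, hσx, sub_neg_eq_add]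
      simp only [LinearMap.neg_apply, map_neg, map_smul, map_add, LieAlgebra.ad_apply]
      rw [← neg_add, smul_neg, neg_neg, ← smul_add, hsum, smul_smul]
      norm_num
end

section
/- Let g be a finite-dimensional Lie algebra over a field of characteristic zero such that the derived subalgebra s := ⁅g, g⁆ is a semisimple Lie algebra and g = Z(g) + s, where Z(g) is the center of g. Let σ be an involutive automorphism of g with eigenspaces h := g^σ and q := g^{−σ}. If ⁅h, q⁆ = 0 (every element of h commutes with every element of q), then q ⊆ Z(g). -/
/-- In a Lie algebra with semisimple derived ideal, no nonzero central element is a bracket. -/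
theorem lie_eq_zero_of_mem_center_of_isSemisimple_derived
    {k g : Type*} [Field k] [LieRing g] [LieAlgebra k g]
    (hs : LieAlgebra.IsSemisimple k
      (↥(⁅(⊤ : LieIdeal k g), (⊤ : LieIdeal k g)⁆ : LieIdeal k g)))
    {x y : g} (h : ⁅x, y⁆ ∈ LieAlgebra.center k g) : ⁅x, y⁆ = 0 := by
  have hmem : ⁅x, y⁆ ∈ (⁅(⊤ : LieIdeal k g), (⊤ : LieIdeal k g)⁆ : LieIdeal k g) :=
    LieSubmodule.lie_mem_lie (LieSubmodule.mem_top x) (LieSubmodule.mem_top y)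
  have hz : (⟨⁅x, y⁆, hmem⟩ : (⁅(⊤ : LieIdeal k g), (⊤ : LieIdeal k g)⁆ : LieIdeal k g)) ∈
      LieAlgebra.center k (⁅(⊤ : LieIdeal k g), (⊤ : LieIdeal k g)⁆ : LieIdeal k g) := by
    rw [LieModule.mem_maxTrivSubmodule] at h ⊢
    exact fun a => Subtype.ext (h a)
  rw [LieAlgebra.center_eq_bot, LieSubmodule.mem_bot] at hz
  exact congrArg Subtype.val hz

/-- A vector commuting with both eigenspaces of an involution is central. -/
theorem mem_center_of_involution
    {k g : Type*} [Field k] [CharZero k] [LieRing g] [LieAlgebra k g]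
    (σ : g ≃ₗ⁅k⁆ g) (hσ : ∀ x, σ (σ x) = x) {z : g}
    (hpos : ∀ x, σ x = x → ⁅x, z⁆ = 0) (hneg : ∀ x, σ x = -x → ⁅x, z⁆ = 0) :
    z ∈ LieAlgebra.center k g := by
  rw [LieModule.mem_maxTrivSubmodule]
  intro x
  have hx : (2 : k) • x = (x + σ x) + (x - σ x) := by rw [two_smul]; abel
  have h2 : (2 : k) • ⁅x, z⁆ = 0 := by
    rw [← smul_lie, hx, add_lie, hpos _ (by rw [map_add, hσ, add_comm]),
      hneg _ (by rw [map_sub, hσ, neg_sub]), add_zero]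
  exact (smul_eq_zero.mp h2).resolve_left two_ne_zero


/-- Let `g` be a finite-dimensional reductive Lie algebra over a field of
characteristic zero (i.e. the derived subalgebra `s = ⁅g,g⁆` is semisimple and
`g = Z(g) + s`), and let `σ` be an involutive automorphism with eigenspaces `h`, `q`.
If `⁅h, q⁆ = 0` then `q ⊆ Z(g)`. -/
theorem neg_eigenspace_central_of_bracket_eq_zero
    {k g : Type*} [Field k] [CharZero k] [LieRing g] [LieAlgebra k g]
    [FiniteDimensional k g]
    (hs : LieAlgebra.IsSemisimple k
      (↥(⁅(⊤ : LieIdeal k g), (⊤ : LieIdeal k g)⁆ : LieIdeal k g)))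
    (hred : LieAlgebra.center k g ⊔ ⁅(⊤ : LieIdeal k g), (⊤ : LieIdeal k g)⁆ = ⊤)
    (σ : g ≃ₗ⁅k⁆ g) (hσ : ∀ x, σ (σ x) = x)
    (hcomm : ∀ x y : g, σ x = x → σ y = -y → ⁅x, y⁆ = 0) :
    ∀ y : g, σ y = -y → y ∈ LieAlgebra.center k g := by
  intro y hy
  refine mem_center_of_involution σ hσ (fun x hx => hcomm x y hx hy) fun x hx =>
    lie_eq_zero_of_mem_center_of_isSemisimple_derived hs ?_
  refine mem_center_of_involution σ hσ (fun a ha => ?_) fun a ha => ?_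
  · rw [leibniz_lie, hcomm a x ha hx, hcomm a y ha hy, zero_lie, lie_zero, add_zero]
  · rw [← lie_skew, hcomm _ a (by rw [LieEquiv.map_lie, hx, hy, neg_lie, lie_neg, neg_neg]) ha,
      neg_zero]
end

section
/- Let V be a finite-dimensional real inner product space, let A be an invertible linear endomorphism of V such that the set of all integer powers {Aⁿ : n ∈ ℤ} is bounded (e.g. in the operator norm), and let B be a self-adjoint positive-definite linear endomorphism of V with A ∘ B = B ∘ A. Then for every v ∈ V one has A(B(v)) = v if and only if A(v) = v and B(v) = v; equivalently, ker(A∘B − id) = ker(A − id) ∩ ker(B − id). -/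
open scoped RealInnerProductSpace

/-- A convex sequence of reals that is bounded above does not increase at its first step. -/
theorem apply_one_le_apply_zero_of_convex_of_bddAbove {f : ℕ → ℝ} {M : ℝ}
    (hf : ∀ n, 2 * f (n + 1) ≤ f n + f (n + 2)) (hM : ∀ n, f n ≤ M) : f 1 ≤ f 0 := by
  by_contra! h
  have hstep : ∀ n, f 1 - f 0 ≤ f (n + 1) - f n := by
    intro n
    induction n with
    | zero => simp
    | succ k ih => linarith [hf k]
  have hlin : ∀ n : ℕ, f 0 + n * (f 1 - f 0) ≤ f n := by
    intro n
    induction n with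
    | zero => simp
    | succ k ih =>
      push_cast
      linarith [hstep k]
  obtain ⟨n, hn⟩ := exists_nat_gt ((M - f 0) / (f 1 - f 0))
  rw [div_lt_iff₀ (sub_pos.mpr h)] at hn
  linarith [hlin n, hM n]

/-- A bounded two-sided orbit of a symmetric operator is 2-periodic. -/
theorem eq_of_symmetric_of_bounded_orbit {V : Type*} [NormedAddCommGroup V]
    [InnerProductSpace ℝ V] {B : V →ₗ[ℝ] V} (hB : ∀ v w : V, ⟪B v, w⟫ = ⟪v, B w⟫)
    {x : ℤ → V} (hx : ∀ n, B (x (n + 1)) = x n) {M : ℝ} (hM : ∀ n, ‖x n‖ ≤ M) :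
    x 1 = x (-1) := by
  have hdiff : ∀ n, ‖x (n + 1) - x (n - 1)‖ ^ 2
      = ‖x (n + 1)‖ ^ 2 + ‖x (n - 1)‖ ^ 2 - 2 * ‖x n‖ ^ 2 := by
    intro n
    have hpred : B (x n) = x (n - 1) := by simpa using hx (n - 1)
    have hinner : ⟪x (n + 1), x (n - 1)⟫ = ‖x n‖ ^ 2 := by
      rw [← hpred, ← hB, hx, real_inner_self_eq_norm_sq]
    rw [norm_sub_sq_real, hinner]
    ring
  have hbound : ∀ n, ‖x n‖ ^ 2 ≤ M ^ 2 := fun n ↦ by gcongr; exact hM n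
  have hright : ‖x 1‖ ^ 2 ≤ ‖x 0‖ ^ 2 := by
    refine apply_one_le_apply_zero_of_convex_of_bddAbove (f := fun n : ℕ ↦ ‖x n‖ ^ 2)
      (fun n ↦ ?_) (fun n ↦ hbound n)
    have h := hdiff (n + 1)
    rw [show (n : ℤ) + 1 + 1 = n + 2 by ring, add_sub_cancel_right] at h
    push_cast
    linarith [sq_nonneg ‖x (n + 2) - x n‖]
  have hleft : ‖x (-1)‖ ^ 2 ≤ ‖x 0‖ ^ 2 := by
    refine apply_one_le_apply_zero_of_convex_of_bddAbove (f := fun n : ℕ ↦ ‖x (-n)‖ ^ 2)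
      (fun n ↦ ?_) (fun n ↦ hbound (-n))
    have h := hdiff (-(n + 1))
    rw [show -((n : ℤ) + 1) + 1 = -n by ring,
      show -((n : ℤ) + 1) - 1 = -(n + 2) by ring] at h
    push_cast
    linarith [sq_nonneg ‖x (-n) - x (-(n + 2))‖]
  have h := hdiff 0
  rw [zero_add, zero_sub] at h
  have hzero : ‖x 1 - x (-1)‖ ^ 2 = 0 := le_antisymm (by linarith) (sq_nonneg _)
  simpa [sub_eq_zero] using hzero

/-- Let `V` be a finite-dimensional real inner product space, `A` an invertible
endomorphism whose integer powers are uniformly bounded, and `B` a self-adjoint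
positive-definite endomorphism commuting with `A`.  Then `A (B v) = v ↔ A v = v ∧ B v = v`. -/
theorem fixed_of_bounded_mul_posdef
    {V : Type*} [NormedAddCommGroup V] [InnerProductSpace ℝ V] [FiniteDimensional ℝ V]
    (A : V ≃ₗ[ℝ] V)
    (hA : ∃ C : ℝ, ∀ (m : ℤ) (v : V), ‖(A ^ m) v‖ ≤ C * ‖v‖)
    (B : V →ₗ[ℝ] V)
    (hBsa : ∀ v w : V, ⟪B v, w⟫ = ⟪v, B w⟫)
    (hBpos : ∀ v : V, v ≠ 0 → 0 < ⟪B v, v⟫)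
    (hcomm : ∀ v : V, A (B v) = B (A v)) :
    ∀ v : V, A (B v) = v ↔ A v = v ∧ B v = v := by
  intro v
  refine ⟨fun hv ↦ ?_, fun ⟨hAv, hBv⟩ ↦ by rw [hBv, hAv]⟩
  obtain ⟨C, hC⟩ := hA
  have hsucc : ∀ n : ℤ, (A ^ (n + 1)) v = A ((A ^ n) v) := fun n ↦ by
    rw [add_comm, zpow_one_add, LinearEquiv.mul_apply]
  have horbit : ∀ n : ℤ, B ((A ^ (n + 1)) v) = (A ^ n) v := by
    intro n
    induction n using Int.induction_on with
    | zero => simpa [← hcomm] using hv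
    | succ k ih => rw [hsucc, ← hcomm, ih, hsucc]
    | pred k ih =>
      apply A.injective
      rw [hcomm, ← hsucc, ← hsucc, sub_add_cancel, ih]
  have hper : A v = (A ^ (-1 : ℤ)) v := by
    simpa only [zpow_one] using
      eq_of_symmetric_of_bounded_orbit (x := fun n : ℤ ↦ (A ^ n) v) hBsa horbit (hC · v)
  have hBv : B v = A v := by
    rw [hper]
    simpa using horbit (-1)
  have hAv : A v = v := by
    by_contra hne
    have hneg : B (A v - v) = -(A v - v) := by
      rw [map_sub, ← hcomm, hv, hBv, neg_sub]
    have hpos := hBpos _ (sub_ne_zero.mpr hne)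
    rw [hneg, inner_neg_left, real_inner_self_eq_norm_sq] at hpos
    linarith [sq_nonneg ‖A v - v‖]
  exact ⟨hAv, hBv.trans hAv⟩
end

section
/- Let N be a positive integer and ξ ∈ Mat_N(ℂ), with skew-Hermitian part ξ_k := (ξ − ξᴴ)/2 and Hermitian part ξ_p := (ξ + ξᴴ)/2. Then Re(tr((η·ξ − ξ·η)·ξᴴ)) = 0 for every Hermitian matrix η ∈ Mat_N(ℂ) if and only if ξ_k·ξ_p = ξ_p·ξ_k. -/
open Matrix

open scoped ComplexOrder in
/-- A complex matrix `A` vanishes as soon as the real part of `tr (A * Aᴴ)` does. -/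
theorem eq_zero_of_re_trace_mul_conjTranspose_self {m n : Type*} [Fintype m] [Fintype n]
    {A : Matrix m n ℂ} (h : (A * Aᴴ).trace.re = 0) : A = 0 := by
  have hnonneg : 0 ≤ (A * Aᴴ).trace := (posSemidef_self_mul_conjTranspose A).trace_nonneg
  exact trace_mul_conjTranspose_self_eq_zero_iff.mp
    (Complex.ext h (Complex.nonneg_iff.mp hnonneg).2.symm)

theorem trace_commutator_mul {n R : Type*} [Fintype n] [CommRing R] (A B C : Matrix n n R) :
    ((A * B - B * A) * C).trace = (A * (B * C - C * B)).trace := by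
  rw [sub_mul, mul_sub, trace_sub, trace_sub, mul_assoc, mul_assoc, trace_mul_comm B, mul_assoc]

theorem half_smul_sub_commute_half_smul_add_iff {n : Type*} [Fintype n] (A B : Matrix n n ℂ) :
    ((1 / 2 : ℂ) • (A - B)) * ((1 / 2 : ℂ) • (A + B)) =
        ((1 / 2 : ℂ) • (A + B)) * ((1 / 2 : ℂ) • (A - B)) ↔ A * B - B * A = 0 := by
  have key : ((1 / 2 : ℂ) • (A - B)) * ((1 / 2 : ℂ) • (A + B)) -
      ((1 / 2 : ℂ) • (A + B)) * ((1 / 2 : ℂ) • (A - B)) = (1 / 2 : ℂ) • (A * B - B * A) := by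
    simp only [smul_mul_assoc, mul_smul_comm, sub_mul, mul_sub, add_mul, mul_add]
    module
  rw [← sub_eq_zero, key, smul_eq_zero]
  norm_num

/-- For `ξ ∈ Mat_N(ℂ)` with skew-Hermitian part `ξ_k = (ξ - ξᴴ)/2` and
Hermitian part `ξ_p = (ξ + ξᴴ)/2`, one has `Re (tr ((η·ξ - ξ·η)·ξᴴ)) = 0` for every
Hermitian `η` if and only if `ξ_k` and `ξ_p` commute. -/
theorem gradient_zero_iff_parts_commute
    {N : ℕ} (hN : 0 < N) (ξ : Matrix (Fin N) (Fin N) ℂ) :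
    (∀ η : Matrix (Fin N) (Fin N) ℂ, ηᴴ = η →
        ((η * ξ - ξ * η) * ξᴴ).trace.re = 0) ↔
      ((1 / 2 : ℂ) • (ξ - ξᴴ)) * ((1 / 2 : ℂ) • (ξ + ξᴴ)) =
        ((1 / 2 : ℂ) • (ξ + ξᴴ)) * ((1 / 2 : ℂ) • (ξ - ξᴴ)) := by
  rw [half_smul_sub_commute_half_smul_add_iff]
  simp only [trace_commutator_mul]
  refine ⟨fun h => ?_, fun h η _ => by simp [h]⟩
  have hC : (ξ * ξᴴ - ξᴴ * ξ)ᴴ = ξ * ξᴴ - ξᴴ * ξ := by simp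
  apply eq_zero_of_re_trace_mul_conjTranspose_self
  rw [hC]
  exact h _ hC
end
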